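/- Let T > 0, let ρ : [0,T] × T^d → [δ₀,δ₁] be continuous with 0 < δ₀ ≤ δ₁ < ∞, and let F : [0,T] × T^d → ℝ be bounded and continuous. Then for all sufficiently small γ > 0 and every t ∈ [0,T], limsup_{l→∞} limsup_{N→∞} (1/(γN^d)) · ∫₀ᵗ log E_{ν^N_{ρ(s,·)}}[ exp{ γ · Σ_{x ∈ T_N^d} F(s, x/N) · M(η^l(x), ρ(s, x/N)) } ] ds ≤ 0, where ν^N_{ρ(s,·)} is the product measure on configurations η : T_N^d → ℕ whose marginal at site x is ν_{ρ(s, x/N)}. -/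

import Mathlib

/-!
STATEMENT 17: (Proposition on the exponential estimate, time-integrated form.)
For sufficiently small γ > 0 and every t ∈ [0,T],
limsup_l limsup_N (1/(γN^d)) ∫₀ᵗ log E_{ν^N_{ρ(s,·)}}[exp{γ Σ_x F(s,x/N) M(η^l(x),ρ(s,x/N))}] ds ≤ 0.
-/

open MeasureTheory
open scoped BigOperators

/-- `g(k)! = g(1)⋯g(k)`, with `g(0)! = 1`. -/
noncomputable def gFact (g : ℕ → ℝ) (k : ℕ) : ℝ := ∏ j ∈ Finset.Icc 1 k, g j

/-- The partition function `Z(ψ) = Σ_k ψ^k / g(k)!`. -/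
noncomputable def partZ (g : ℕ → ℝ) (ψ : ℝ) : ℝ := ∑' k : ℕ, ψ ^ k / gFact g k

/-- The mean particle number per site `R(ψ)` under `ν̄_ψ`. -/
noncomputable def meanR (g : ℕ → ℝ) (ψ : ℝ) : ℝ :=
  ∑' k : ℕ, (k : ℝ) * ψ ^ k / (partZ g ψ * gFact g k)

/-- The single-site marginal of `ν̄_ψ`: the measure on ℕ with
`ν̄_ψ{k} = ψ^k/(Z(ψ)g(k)!)`. -/
noncomputable def siteMeasure (g : ℕ → ℝ) (ψ : ℝ) : Measure ℕ :=
  Measure.sum (fun k : ℕ =>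
    (ENNReal.ofReal (ψ ^ k / (partZ g ψ * gFact g k))) • Measure.dirac k)

/-- `M(λ,β) = p̃(λ) − p̃(β) − p̃′(β)(λ−β)` with `p̃ = Φ²`, `p̃′ = 2ΦΦ′`. -/
noncomputable def Mfun (Φ Φ' : ℝ → ℝ) (lam β : ℝ) : ℝ :=
  (Φ lam) ^ 2 - (Φ β) ^ 2 - 2 * Φ β * Φ' β * (lam - β)

/-- The macroscopic location `x/N ∈ T^d` of the microscopic site `x ∈ T_N^d`. -/
noncomputable def embed (d N : ℕ) (x : Fin d → ZMod N) :
    Fin d → AddCircle (1 : ℝ) :=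
  fun i => (((((x i).val : ℝ)) / (N : ℝ) : ℝ) : AddCircle (1 : ℝ))

/-- `η^l(x)`: the empirical density in the box of radius `l` centered at `x`. -/
noncomputable def blockAvg (d N l : ℕ) (x : Fin d → ZMod N)
    (η : (Fin d → ZMod N) → ℕ) : ℝ :=
  ((2 * l + 1 : ℝ) ^ d)⁻¹ *
    ∑ m ∈ Fintype.piFinset (fun _ : Fin d => Finset.Icc (-(l : ℤ)) (l : ℤ)),
      (η (fun i => x i + (m i : ZMod N)) : ℝ)


theorem gFact_succ (g : ℕ → ℝ) (k : ℕ) : gFact g (k + 1) = gFact g k * g (k + 1) := by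
  unfold gFact
  rw [Finset.prod_Icc_succ_top (by omega)]

theorem gFact_zero (g : ℕ → ℝ) : gFact g 0 = 1 := by
  simp [gFact]

theorem gFact_pos {g : ℕ → ℝ} (hg_nonneg : ∀ k, 0 ≤ g k) (hg_zero : ∀ k, g k = 0 ↔ k = 0)
    (k : ℕ) : 0 < gFact g k := by
  refine Finset.prod_pos fun j hj => lt_of_le_of_ne (hg_nonneg j) fun h => ?_
  have := (hg_zero j).1 h.symm
  have := (Finset.mem_Icc.1 hj).1
  omega

theorem one_le_partZ {g : ℕ → ℝ} (hpos : ∀ k, 0 < gFact g k) {ψ : ℝ} (hψ : 0 ≤ ψ)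
    (hs : Summable (fun k : ℕ => ψ ^ k / gFact g k)) : 1 ≤ partZ g ψ := by
  have h := hs.le_tsum 0 (fun k _ => div_nonneg (pow_nonneg hψ k) (hpos k).le)
  simpa [gFact_zero, partZ] using h

theorem summable_natCast_mul_pow_div_gFact {g : ℕ → ℝ} (hpos : ∀ k, 0 < gFact g k) {ψ r : ℝ}
    (hψ : 0 ≤ ψ) (hr : ψ < r) (hs : Summable (fun k : ℕ => r ^ k / gFact g k)) :
    Summable (fun k : ℕ => (k : ℝ) * (ψ ^ k / gFact g k)) := by
  have hr0 : 0 < r := hψ.trans_lt hr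
  have hlim : Filter.Tendsto (fun k : ℕ => (k : ℝ) * (ψ / r) ^ k) Filter.atTop (nhds 0) :=
    tendsto_self_mul_const_pow_of_lt_one (by positivity) ((div_lt_one hr0).2 hr)
  refine summable_of_isBigO_nat hs (Asymptotics.IsBigO.of_bound 1 ?_)
  filter_upwards [hlim.eventually (gt_mem_nhds zero_lt_one)] with k hk
  have hg := hpos k
  have hrk : 0 < r ^ k := by positivity
  rw [Real.norm_of_nonneg (by positivity), Real.norm_of_nonneg (by positivity), one_mul,
    ← mul_div_assoc]
  gcongr
  rw [div_pow, ← mul_div_assoc, div_lt_one hrk] at hk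
  exact hk.le

/-- The weight `ν̄_ψ{k}`. -/
noncomputable def siteWeight (g : ℕ → ℝ) (ψ : ℝ) (k : ℕ) : ℝ :=
  ψ ^ k / (partZ g ψ * gFact g k)

theorem siteWeight_eq (g : ℕ → ℝ) (ψ : ℝ) (k : ℕ) :
    siteWeight g ψ k = (partZ g ψ)⁻¹ * (ψ ^ k / gFact g k) := by
  rw [siteWeight, div_mul_eq_div_div, div_right_comm, div_eq_inv_mul]

theorem siteWeight_nonneg {g : ℕ → ℝ} (hpos : ∀ k, 0 < gFact g k) {ψ : ℝ} (hψ : 0 ≤ ψ) (k : ℕ)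
    (hs : Summable (fun k : ℕ => ψ ^ k / gFact g k)) : 0 ≤ siteWeight g ψ k := by
  have := one_le_partZ hpos hψ hs
  have := hpos k
  unfold siteWeight
  positivity

theorem hasSum_siteWeight {g : ℕ → ℝ} (hpos : ∀ k, 0 < gFact g k) {ψ : ℝ} (hψ : 0 ≤ ψ)
    (hs : Summable (fun k : ℕ => ψ ^ k / gFact g k)) : HasSum (siteWeight g ψ) 1 := by
  have h1 := one_le_partZ hpos hψ hs
  have h := hs.hasSum.mul_left (partZ g ψ)⁻¹
  rw [← partZ, inv_mul_cancel₀ (by linarith)] at h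
  simpa only [← siteWeight_eq] using h

theorem hasSum_natCast_mul_siteWeight {g : ℕ → ℝ} (hpos : ∀ k, 0 < gFact g k) {ψ r : ℝ}
    (hψ : 0 ≤ ψ) (hr : ψ < r) (hs : Summable (fun k : ℕ => r ^ k / gFact g k)) :
    HasSum (fun k : ℕ => (k : ℝ) * siteWeight g ψ k) (meanR g ψ) := by
  have h := (summable_natCast_mul_pow_div_gFact hpos hψ hr hs).mul_left (partZ g ψ)⁻¹
  have heq : (fun k : ℕ => (partZ g ψ)⁻¹ * ((k : ℝ) * (ψ ^ k / gFact g k))) =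
      fun k : ℕ => (k : ℝ) * siteWeight g ψ k := by
    ext k
    rw [siteWeight_eq]
    ring
  rw [heq] at h
  have hmean : meanR g ψ = ∑' k : ℕ, (k : ℝ) * siteWeight g ψ k := by
    simp only [meanR, siteWeight, mul_div_assoc]
  rw [hmean]
  exact h.hasSum

theorem hasSum_rate_mul_siteWeight {g : ℕ → ℝ} (hpos : ∀ k, 0 < gFact g k) (hg0 : g 0 = 0)
    {ψ : ℝ} (hψ : 0 ≤ ψ) (hs : Summable (fun k : ℕ => ψ ^ k / gFact g k)) :
    HasSum (fun k : ℕ => g k * siteWeight g ψ k) ψ := by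
  have h := (hasSum_siteWeight hpos hψ hs).mul_left ψ
  rw [mul_one] at h
  refine (hasSum_nat_add_iff' 1).1 ?_
  simp only [Finset.range_one, Finset.sum_singleton, hg0, zero_mul, sub_zero]
  refine h.congr_fun fun k => ?_
  have h1 := one_le_partZ hpos hψ hs
  have h2 := hpos k
  have h3 := hpos (k + 1)
  rw [gFact_succ] at h3
  have h4 : g (k + 1) ≠ 0 := fun h => by simp [h] at h3
  rw [siteWeight, siteWeight, gFact_succ]
  field_simp
  ring

/-- Under the growth condition the fugacity squared is at most linear in the density. -/
theorem sq_le_mul_meanR {g : ℕ → ℝ} (hpos : ∀ k, 0 < gFact g k) (hg0 : g 0 = 0) {b : ℝ}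
    (hG : ∀ k : ℕ, g k ^ 2 ≤ b * k) {ψ r : ℝ} (hψ : 0 ≤ ψ) (hr : ψ < r)
    (hs : Summable (fun k : ℕ => ψ ^ k / gFact g k))
    (hsr : Summable (fun k : ℕ => r ^ k / gFact g k)) : ψ ^ 2 ≤ b * meanR g ψ := by
  have h1 := (hasSum_rate_mul_siteWeight hpos hg0 hψ hs).mul_left (2 * ψ)
  have h2 := ((hasSum_natCast_mul_siteWeight hpos hψ hr hsr).mul_left b).add
    ((hasSum_siteWeight hpos hψ hs).mul_left (ψ ^ 2))
  have := hasSum_le (fun k => ?_) h1 h2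
  · nlinarith
  · have hw := siteWeight_nonneg hpos hψ k hs
    have : 2 * ψ * g k ≤ b * k + ψ ^ 2 := by nlinarith [hG k, sq_nonneg (g k - ψ)]
    nlinarith [mul_le_mul_of_nonneg_right this hw]

theorem lintegral_siteMeasure (g : ℕ → ℝ) (ψ : ℝ) (f : ℕ → ENNReal) :
    ∫⁻ k, f k ∂(siteMeasure g ψ) = ∑' k, ENNReal.ofReal (siteWeight g ψ k) * f k := by
  simp [siteMeasure, siteWeight, lintegral_sum_measure, lintegral_smul_measure]

theorem isProbabilityMeasure_siteMeasure {g : ℕ → ℝ} (hpos : ∀ k, 0 < gFact g k) {ψ : ℝ}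
    (hψ : 0 ≤ ψ) (hs : Summable (fun k : ℕ => ψ ^ k / gFact g k)) :
    IsProbabilityMeasure (siteMeasure g ψ) := by
  have h := hasSum_siteWeight hpos hψ hs
  refine ⟨?_⟩
  rw [← lintegral_one, lintegral_siteMeasure]
  simp only [mul_one]
  rw [← ENNReal.ofReal_tsum_of_nonneg (fun k => siteWeight_nonneg hpos hψ k hs) h.summable,
    h.tsum_eq, ENNReal.ofReal_one]

theorem exp_le_one_add_add_sq_mul_exp_abs (x : ℝ) :
    Real.exp x ≤ 1 + x + x ^ 2 * Real.exp |x| := by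
  have h := Complex.norm_exp_sub_sum_le_norm_mul_exp (x : ℂ) 2
  have hcast : Complex.exp x - ∑ m ∈ Finset.range 2, (x : ℂ) ^ m / (m.factorial : ℂ) =
      ((Real.exp x - (1 + x) : ℝ) : ℂ) := by
    simp [Finset.sum_range_succ]
  rw [hcast, Complex.norm_real, Complex.norm_real, Real.norm_eq_abs, Real.norm_eq_abs, sq_abs] at h
  linarith [(abs_le.1 h).2]

/-- A centered variable with finite exponential moments has sub-Gaussian moment generating function
near the origin, uniformly in the fugacity. -/
theorem lintegral_siteMeasure_exp_le {g : ℕ → ℝ} (hpos : ∀ k, 0 < gFact g k) {ψ r a₀ β δ₁ a : ℝ}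
    (hψ : 0 ≤ ψ) (ha₀ : 0 < a₀) (hψr : ψ * Real.exp (2 * a₀) ≤ r)
    (hβ : 0 ≤ β) (hβδ : β ≤ δ₁) (hmean : meanR g ψ = β)
    (hsr : Summable (fun k : ℕ => r ^ k / gFact g k)) (hr : ψ < r) (ha : |a| ≤ a₀) :
    ∫⁻ k, ENNReal.ofReal (Real.exp (a * (k - β))) ∂(siteMeasure g ψ) ≤
      ENNReal.ofReal (Real.exp (2 / a₀ ^ 2 * Real.exp (2 * a₀ * δ₁) * partZ g r * a ^ 2)) := by
  have hr0 : 0 ≤ r := hψ.trans hr.le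
  have hs : Summable (fun k : ℕ => ψ ^ k / gFact g k) :=
    Summable.of_nonneg_of_le (fun k => div_nonneg (pow_nonneg hψ k) (hpos k).le)
      (fun k => by have := hpos k; gcongr) hsr
  have hZ := one_le_partZ hpos hψ hs
  have hw := fun k => siteWeight_nonneg hpos hψ k hs
  set B := 2 / a₀ ^ 2 * Real.exp (2 * a₀ * δ₁) with hB
  have hB0 : 0 ≤ B := by positivity
  have hbound : ∀ k : ℕ, siteWeight g ψ k * Real.exp (a * (k - β)) ≤
      siteWeight g ψ k + a * (k * siteWeight g ψ k - β * siteWeight g ψ k) +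
        a ^ 2 * B * (r ^ k / gFact g k) := by
    intro k
    have hX : |(k : ℝ) - β| ≤ k + δ₁ := by
      rw [abs_le]; constructor <;> linarith [(Nat.cast_nonneg k : (0 : ℝ) ≤ k)]
    have h1 := exp_le_one_add_add_sq_mul_exp_abs (a * ((k : ℝ) - β))
    have h2 : (a₀ * |(k : ℝ) - β|) ^ 2 / 2 ≤ Real.exp (a₀ * |(k : ℝ) - β|) :=
      by simpa using Real.pow_div_factorial_le_exp _ (by positivity : 0 ≤ a₀ * |(k : ℝ) - β|) 2
    have h3 : Real.exp |a * ((k : ℝ) - β)| ≤ Real.exp (a₀ * |(k : ℝ) - β|) := by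
      rw [abs_mul]; gcongr
    have h4 : ((k : ℝ) - β) ^ 2 * Real.exp |a * ((k : ℝ) - β)| ≤
        B * Real.exp (2 * a₀) ^ k := by
      have h5 : ((k : ℝ) - β) ^ 2 ≤ 2 / a₀ ^ 2 * Real.exp (a₀ * |(k : ℝ) - β|) := by
        rw [mul_pow, sq_abs] at h2
        rw [div_mul_eq_mul_div, le_div_iff₀ (by positivity)]
        linarith
      calc _ ≤ 2 / a₀ ^ 2 * Real.exp (a₀ * |(k : ℝ) - β|) * Real.exp (a₀ * |(k : ℝ) - β|) := by
            gcongr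
        _ = 2 / a₀ ^ 2 * Real.exp (2 * a₀ * |(k : ℝ) - β|) := by
            rw [mul_assoc, ← Real.exp_add]; ring_nf
        _ ≤ 2 / a₀ ^ 2 * Real.exp (2 * a₀ * (k + δ₁)) := by gcongr
        _ = B * Real.exp (2 * a₀) ^ k := by
            rw [hB, ← Real.exp_nat_mul, mul_assoc (2 / a₀ ^ 2), ← Real.exp_add]; ring_nf
    have h6 : siteWeight g ψ k * Real.exp (2 * a₀) ^ k ≤ r ^ k / gFact g k := by
      have := hpos k
      have h7 : siteWeight g ψ k ≤ ψ ^ k / gFact g k := by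
        rw [siteWeight_eq]
        exact mul_le_of_le_one_left (by positivity) (inv_le_one_of_one_le₀ hZ)
      calc _ ≤ ψ ^ k / gFact g k * Real.exp (2 * a₀) ^ k := by gcongr
        _ = (ψ * Real.exp (2 * a₀)) ^ k / gFact g k := by rw [mul_pow]; ring
        _ ≤ _ := by gcongr
    calc siteWeight g ψ k * Real.exp (a * (k - β))
        ≤ siteWeight g ψ k * (1 + a * ((k : ℝ) - β) + a ^ 2 * (B * Real.exp (2 * a₀) ^ k)) := by
          refine mul_le_mul_of_nonneg_left (h1.trans ?_) (hw k)
          rw [mul_pow, mul_assoc]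
          gcongr
      _ = siteWeight g ψ k + a * (k * siteWeight g ψ k - β * siteWeight g ψ k) +
          a ^ 2 * B * (siteWeight g ψ k * Real.exp (2 * a₀) ^ k) := by ring
      _ ≤ _ := by gcongr
  have hS := ((hasSum_siteWeight hpos hψ hs).add
    (((hasSum_natCast_mul_siteWeight hpos hψ hr hsr).sub
      ((hasSum_siteWeight hpos hψ hs).mul_left β)).mul_left a)).add
        (hsr.hasSum.mul_left (a ^ 2 * B))
  rw [hmean, ← partZ] at hS
  have hsum : Summable (fun k : ℕ => siteWeight g ψ k * Real.exp (a * (k - β))) :=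
    Summable.of_nonneg_of_le (fun k => mul_nonneg (hw k) (Real.exp_nonneg _)) hbound hS.summable
  rw [lintegral_siteMeasure]
  simp_rw [← ENNReal.ofReal_mul (hw _)]
  rw [← ENNReal.ofReal_tsum_of_nonneg
    (fun k => mul_nonneg (hw k) (Real.exp_nonneg _)) hsum]
  refine ENNReal.ofReal_le_ofReal ((hasSum_le hbound hsum.hasSum hS).trans ?_)
  have := Real.add_one_le_exp (B * partZ g r * a ^ 2)
  nlinarith

theorem analyticAt_tsum_mul_pow {c : ℕ → ℝ} {r ψ : ℝ}
    (hs : Summable (fun k : ℕ => |c k| * r ^ k)) (hψ : |ψ| < r) :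
    AnalyticAt ℝ (fun x : ℝ => ∑' k : ℕ, c k * x ^ k) ψ := by
  have hr : 0 < r := (abs_nonneg ψ).trans_lt hψ
  let p := FormalMultilinearSeries.ofScalars ℝ c
  have hrad : ENNReal.ofReal r ≤ p.radius := by
    refine p.le_radius_of_summable ?_
    simpa [p, Real.coe_toNNReal r hr.le] using hs
  have hp : HasFPowerSeriesOnBall p.sum p 0 p.radius :=
    p.hasFPowerSeriesOnBall ((ENNReal.ofReal_pos.2 hr).trans_le hrad)
  have hmem : ψ ∈ Metric.eball (0 : ℝ) p.radius := by
    refine lt_of_lt_of_le ?_ hrad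
    rw [edist_zero_right, ← ofReal_norm, Real.norm_eq_abs]
    exact (ENNReal.ofReal_lt_ofReal_iff hr).2 hψ
  have h := hp.analyticAt_of_mem hmem
  have heq : p.sum = fun x : ℝ => ∑' k : ℕ, c k * x ^ k :=
    FormalMultilinearSeries.ofScalarsSum_eq_tsum (E := ℝ) c
  rwa [heq] at h

theorem analyticAt_meanR {g : ℕ → ℝ} (hpos : ∀ k, 0 < gFact g k) {ψ r r' : ℝ}
    (hψ : 0 ≤ ψ) (hr : ψ < r) (hr' : r < r') (hs : Summable (fun k : ℕ => r' ^ k / gFact g k)) :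
    AnalyticAt ℝ (meanR g) ψ := by
  have hr0 : 0 ≤ r := hψ.trans hr.le
  have hsr : Summable (fun k : ℕ => r ^ k / gFact g k) :=
    Summable.of_nonneg_of_le (fun k => div_nonneg (pow_nonneg hr0 k) (hpos k).le)
      (fun k => by have := hpos k; gcongr) hs
  have hsψ : Summable (fun k : ℕ => ψ ^ k / gFact g k) :=
    Summable.of_nonneg_of_le (fun k => div_nonneg (pow_nonneg hψ k) (hpos k).le)
      (fun k => by have := hpos k; gcongr) hsr
  have habs : |ψ| < r := by rwa [abs_of_nonneg hψ]
  have hZ : AnalyticAt ℝ (fun x : ℝ => ∑' k : ℕ, (gFact g k)⁻¹ * x ^ k) ψ := by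
    refine analyticAt_tsum_mul_pow (r := r) (hsr.congr fun k => ?_) habs
    rw [abs_of_pos (inv_pos.2 (hpos k)), div_eq_inv_mul]
  have hN : AnalyticAt ℝ (fun x : ℝ => ∑' k : ℕ, (k * (gFact g k)⁻¹) * x ^ k) ψ := by
    refine analyticAt_tsum_mul_pow (r := r)
      ((summable_natCast_mul_pow_div_gFact hpos hr0 hr' hs).congr fun k => ?_) habs
    rw [abs_of_nonneg (mul_nonneg k.cast_nonneg (inv_pos.2 (hpos k)).le), div_eq_inv_mul, mul_assoc]
  have hZeq : (fun x : ℝ => ∑' k : ℕ, (gFact g k)⁻¹ * x ^ k) = partZ g := by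
    ext x
    simp only [partZ, div_eq_inv_mul]
  have hReq : meanR g = fun x => (partZ g x)⁻¹ * ∑' k : ℕ, (k * (gFact g k)⁻¹) * x ^ k := by
    ext x
    rw [meanR, ← tsum_mul_left]
    refine tsum_congr fun k => ?_
    rw [div_eq_mul_inv, mul_inv]
    ring
  rw [hZeq] at hZ
  rw [hReq]
  have := one_le_partZ hpos hψ hsψ
  exact (hZ.inv (by linarith)).mul hN

/-- The inverse `Φ` of the analytic function `R` inherits a continuously differentiable
derivative. -/
theorem contDiffOn_deriv_of_inverse {R Φ Φ' : ℝ → ℝ}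
    (hR : ∀ α, 0 < α → AnalyticAt ℝ R (Φ α)) (hinv : ∀ α, 0 < α → R (Φ α) = α)
    (hderiv : ∀ α, 0 < α → HasDerivAt Φ (Φ' α) α) (hcont : ContinuousOn Φ' (Set.Ioi 0)) :
    ContDiffOn ℝ 1 Φ (Set.Ioi 0) ∧ ContDiffOn ℝ 1 Φ' (Set.Ioi 0) := by
  have hΦ : ContDiffOn ℝ 1 Φ (Set.Ioi 0) := by
    rw [show (1 : WithTop ℕ∞) = 0 + 1 by simp, contDiffOn_succ_iff_deriv_of_isOpen isOpen_Ioi]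
    refine ⟨fun α hα => (hderiv α hα).differentiableAt.differentiableWithinAt, by simp, ?_⟩
    rw [contDiffOn_zero]
    exact hcont.congr fun α hα => (hderiv α hα).deriv
  refine ⟨hΦ, ?_⟩
  have hmul : ∀ α, 0 < α → deriv R (Φ α) * Φ' α = 1 := by
    intro α hα
    have h1 := (hR α hα).differentiableAt.hasDerivAt.comp α (hderiv α hα)
    have h2 : HasDerivAt (R ∘ Φ) 1 α := by
      refine (hasDerivAt_id α).congr_of_eventuallyEq ?_
      filter_upwards [Ioi_mem_nhds hα] with x hx using hinv x hx
    exact h1.unique h2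
  have heq : ∀ α ∈ Set.Ioi (0 : ℝ), Φ' α = (deriv R (Φ α))⁻¹ := fun α hα =>
    eq_inv_of_mul_eq_one_right (hmul α hα)
  refine ContDiffOn.congr (fun α hα => ?_) heq
  have h1 : ContDiffAt ℝ 1 (deriv R) (Φ α) := (hR α hα).deriv.contDiffAt
  have h2 : ContDiffAt ℝ 1 Φ α := hΦ.contDiffAt (Ioi_mem_nhds hα)
  exact ((h1.comp α h2).inv (left_ne_zero_of_mul_eq_one (hmul α hα))).contDiffWithinAt

theorem exists_abs_Mfun_le {Φ Φ' : ℝ → ℝ} {b δ₀ δ₁ : ℝ} (hb : 0 < b) (hδ₀ : 0 < δ₀)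
    (hδ : δ₀ ≤ δ₁) (hgrowth : ∀ α, 0 ≤ α → Φ α ^ 2 ≤ b * α)
    (hderiv : ∀ α, 0 < α → HasDerivAt Φ (Φ' α) α)
    (hΦ : ContDiffOn ℝ 1 Φ (Set.Ioi 0)) (hΦ' : ContDiffOn ℝ 1 Φ' (Set.Ioi 0)) :
    ∃ C : ℝ, 0 < C ∧ ∀ β ∈ Set.Icc δ₀ δ₁, ∀ lam, 0 ≤ lam →
      |Mfun Φ Φ' lam β| ≤ C * min ((lam - β) ^ 2) |lam - β| := by
  have hsub : Set.Icc (δ₀ / 2) (δ₁ + 1) ⊆ Set.Ioi 0 := fun x hx => by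
    have := hx.1
    exact Set.mem_Ioi.2 (by linarith)
  set q : ℝ → ℝ := fun α => 2 * Φ α * Φ' α with hq
  have hqC : ContDiffOn ℝ 1 q (Set.Ioi 0) := (contDiffOn_const.mul hΦ).mul hΦ'
  obtain ⟨L, hL⟩ := (hqC.mono hsub).exists_lipschitzOnWith (by simp) (convex_Icc _ _) isCompact_Icc
  obtain ⟨P, hP⟩ := (isCompact_Icc (a := δ₀) (b := δ₁)).exists_bound_of_continuousOn
    (hqC.continuousOn.mono fun x hx => Set.mem_Ioi.2 (hδ₀.trans_le hx.1))
  have hP0 : 0 ≤ P := (norm_nonneg _).trans (hP δ₀ ⟨le_rfl, hδ⟩)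
  have hnear : ∀ β ∈ Set.Icc δ₀ δ₁, ∀ lam ∈ Set.Icc (δ₀ / 2) (δ₁ + 1),
      |Mfun Φ Φ' lam β| ≤ L * (lam - β) ^ 2 := by
    intro β hβ lam hlam
    have hβ' : β ∈ Set.Icc (δ₀ / 2) (δ₁ + 1) := ⟨by linarith [hβ.1], by linarith [hβ.2]⟩
    have huI : Set.uIcc β lam ⊆ Set.Icc (δ₀ / 2) (δ₁ + 1) := Set.uIcc_subset_Icc hβ' hlam
    have hd : ∀ x ∈ Set.uIcc β lam,
        HasDerivWithinAt (fun y => Φ y ^ 2 - q β * y) (q x - q β) (Set.uIcc β lam) x := by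
      intro x hx
      have h1 := ((hderiv x (hsub (huI hx))).pow 2).sub ((hasDerivAt_id x).const_mul (q β))
      refine (h1.congr_deriv ?_).hasDerivWithinAt
      simp [hq]
    have hbd : ∀ x ∈ Set.uIcc β lam, ‖q x - q β‖ ≤ L * |lam - β| := by
      intro x hx
      have h1 := hL.norm_sub_le (huI hx) hβ'
      refine h1.trans ?_
      gcongr
      exact Set.abs_sub_left_of_mem_uIcc hx
    have h := (convex_uIcc β lam).norm_image_sub_le_of_norm_hasDerivWithin_le hd hbd
      Set.left_mem_uIcc Set.right_mem_uIcc
    rw [Real.norm_eq_abs, Real.norm_eq_abs, mul_assoc (L : ℝ), abs_mul_abs_self, ← sq] at h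
    refine le_trans (le_of_eq ?_) h
    congr 1
    simp only [Mfun, hq]
    ring
  set A := 2 * b * δ₁ + b + P with hA
  have hA0 : 0 < A := by
    have : 0 < b * δ₁ := mul_pos hb (hδ₀.trans_le hδ)
    linarith
  have hfar : ∀ β ∈ Set.Icc δ₀ δ₁, ∀ lam, 0 ≤ lam →
      |Mfun Φ Φ' lam β| ≤ A * (1 + |lam - β|) := by
    intro β hβ lam hlam
    have h1 := hgrowth lam hlam
    have h2 := hgrowth β (hδ₀.le.trans hβ.1)
    have h3 : |q β * (lam - β)| ≤ P * |lam - β| := by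
      rw [abs_mul]
      gcongr
      exact hP β hβ
    have h4 : b * lam ≤ b * (δ₁ + |lam - β|) := by
      gcongr
      linarith [le_abs_self (lam - β), hβ.2]
    have h5 : b * β ≤ b * δ₁ := by gcongr; exact hβ.2
    have h6 : 0 ≤ 2 * b * δ₁ * |lam - β| := by
      have : 0 ≤ δ₁ := hδ₀.le.trans hδ
      positivity
    have h7 : |Mfun Φ Φ' lam β| ≤ Φ lam ^ 2 + Φ β ^ 2 + |q β * (lam - β)| := by
      have h8 : Mfun Φ Φ' lam β = Φ lam ^ 2 - Φ β ^ 2 - q β * (lam - β) := rfl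
      rw [h8, abs_le]
      have := le_abs_self (q β * (lam - β))
      have := neg_abs_le (q β * (lam - β))
      constructor <;> nlinarith [sq_nonneg (Φ lam), sq_nonneg (Φ β)]
    rw [hA]
    nlinarith
  set r := min (δ₀ / 2) 1 with hr
  have hr0 : 0 < r := by positivity
  have hr1 : r ≤ 1 := min_le_right _ _
  have hC0 : 0 < L + A * (1 / r ^ 2 + 1 / r + 1) := by positivity
  refine ⟨_, hC0, fun β hβ lam hlam => ?_⟩
  rcases le_total |lam - β| r with hx | hx
  · have hmem : lam ∈ Set.Icc (δ₀ / 2) (δ₁ + 1) := by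
      have := abs_le.1 (hx.trans (min_le_left _ _))
      have := abs_le.1 (hx.trans (min_le_right _ _))
      exact ⟨by linarith [hβ.1], by linarith [hβ.2]⟩
    have hmin : min ((lam - β) ^ 2) |lam - β| = (lam - β) ^ 2 := by
      refine min_eq_left ?_
      rw [← sq_abs, sq]
      exact mul_le_of_le_one_left (abs_nonneg _) (hx.trans hr1)
    rw [hmin]
    refine (hnear β hβ lam hmem).trans ?_
    gcongr
    linarith [show 0 ≤ A * (1 / r ^ 2 + 1 / r + 1) by positivity]
  · refine (hfar β hβ lam hlam).trans ?_
    have hLm : 0 ≤ L * min ((lam - β) ^ 2) |lam - β| := by positivity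
    suffices h : 1 + |lam - β| ≤ (1 / r ^ 2 + 1 / r + 1) * min ((lam - β) ^ 2) |lam - β| by
      nlinarith [mul_le_mul_of_nonneg_left h hA0.le]
    have hu : 1 ≤ 1 / r * |lam - β| := by
      rw [one_div, inv_mul_eq_div, le_div_iff₀ hr0]
      linarith
    have hinv : 0 < 1 / r := by positivity
    have hsq : 1 / r ^ 2 = (1 / r) ^ 2 := by rw [one_div_pow]
    rw [hsq, ← sq_abs (lam - β)]
    set u := |lam - β|
    have hu0 : 0 ≤ u := abs_nonneg _
    set v := 1 / r
    rcases min_cases (u ^ 2) u with h | h <;> rw [h.1]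
    · nlinarith [mul_le_mul hu hu zero_le_one (by positivity), mul_le_mul_of_nonneg_right hu hu0]
    · nlinarith [sq_nonneg v, mul_nonneg (sq_nonneg v) hu0]

/-- `min (x ^ 2) |x|` lies below a Huber function, which up to a small error is a maximum of finitely
many affine functions. -/
theorem exists_grid_min_sq_abs_le {m : ℕ} (hm : 0 < m) (x : ℝ) :
    ∃ j ∈ Finset.Icc (-(m : ℤ)) m,
      min (x ^ 2) |x| ≤ 2 * x * (j / m) - (j / m : ℝ) ^ 2 + (1 / m : ℝ) ^ 2 := by
  have hm0 : (0 : ℝ) < m := by exact_mod_cast hm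
  have hsq : (0 : ℝ) ≤ (1 / m) ^ 2 := by positivity
  rcases lt_or_ge 1 |x| with hx | hx
  · rcases lt_abs.1 hx with h | h
    · refine ⟨m, Finset.mem_Icc.2 ⟨by omega, le_rfl⟩, (min_le_right _ _).trans ?_⟩
      rw [Int.cast_natCast, div_self hm0.ne', abs_of_pos (by linarith)]
      linarith
    · refine ⟨-m, Finset.mem_Icc.2 ⟨le_rfl, by omega⟩, (min_le_right _ _).trans ?_⟩
      rw [Int.cast_neg, Int.cast_natCast, neg_div, div_self hm0.ne', abs_of_neg (by linarith)]
      linarith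
  · obtain ⟨h1, h2⟩ := abs_le.1 hx
    refine ⟨⌊x * m⌋, Finset.mem_Icc.2 ⟨Int.le_floor.2 ?_, ?_⟩, (min_le_left _ _).trans ?_⟩
    · push_cast
      nlinarith
    · have h3 : (⌊x * m⌋ : ℝ) ≤ m := (Int.floor_le _).trans (by nlinarith)
      exact_mod_cast h3
    · have h3 : 0 ≤ x - ⌊x * m⌋ / m := by
        rw [sub_nonneg, div_le_iff₀ hm0]
        exact Int.floor_le _
      have h4 : x - ⌊x * m⌋ / m ≤ 1 / m := by
        rw [sub_le_iff_le_add, ← add_div, le_div_iff₀ hm0]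
        linarith [Int.lt_floor_add_one (x * m)]
      nlinarith [pow_le_pow_left₀ h3 h4 2]

theorem lintegral_pi_prod_of_injective {ι J : Type*} [Fintype ι] [Fintype J] {X : Type*}
    [MeasurableSpace X] (μ : ι → Measure X) [∀ i, IsProbabilityMeasure (μ i)] {z : J → ι}
    (hz : Function.Injective z) {φ : J → X → ENNReal} (hφ : ∀ j, Measurable (φ j)) :
    ∫⁻ η, ∏ j, φ j (η (z j)) ∂(Measure.pi μ) = ∏ j, ∫⁻ k, φ j k ∂(μ (z j)) := by
  have h1 : ProbabilityTheory.iIndepFun (fun i (η : ι → X) => η i) (Measure.pi μ) :=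
    ProbabilityTheory.iIndepFun_pi (X := fun _ => id) (fun _ => aemeasurable_id)
  have h2 := (h1.precomp hz).comp φ hφ
  have h3 := ProbabilityTheory.lintegral_prod_eq_prod_lintegral_of_indepFun Finset.univ _ h2
    (fun j => (hφ j).comp (measurable_pi_apply _))
  simp only [Function.comp_apply] at h3
  rw [h3]
  exact Finset.prod_congr rfl fun j _ =>
    (measurePreserving_eval μ (z j)).lintegral_comp (hφ j)

/-- Exponential estimate for a family of disjoint blocks: the sites `z (a, b)`, for fixed `a`, form a
block whose empirical mean is compared with `β a`. -/
theorem lintegral_exp_packing_le {ι A B : Type*} [Fintype ι] [Fintype A] [Fintype B] [Nonempty B]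
    (μ : ι → Measure ℕ) [∀ i, IsProbabilityMeasure (μ i)] {z : A × B → ι}
    (hz : Function.Injective z) (β : A → ℝ) {θ K κ : ℝ} (hθ : 0 ≤ θ) (hκ : 0 ≤ κ)
    (hK : 4 * K * θ ≤ 1)
    (hmgf : ∀ a b c, |c| ≤ 2 * θ → ∫⁻ k, ENNReal.ofReal (Real.exp (c * (k - β a))) ∂(μ (z (a, b))) ≤
      ENNReal.ofReal (Real.exp (K * c ^ 2 + |c| * κ)))
    {m : ℕ} (hm : 0 < m) :
    ∫⁻ η, ENNReal.ofReal (Real.exp (∑ a, θ * (Fintype.card B *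
        min (((Fintype.card B : ℝ)⁻¹ * ∑ b, (η (z (a, b)) : ℝ) - β a) ^ 2)
          |(Fintype.card B : ℝ)⁻¹ * ∑ b, (η (z (a, b)) : ℝ) - β a|))) ∂(Measure.pi μ) ≤
      ENNReal.ofReal ((2 * m + 1) ^ Fintype.card A *
        Real.exp (θ * ((1 / m : ℝ) ^ 2 + 2 * κ)) ^ (Fintype.card A * Fintype.card B)) := by
  classical
  have hm0 : (0 : ℝ) < m := by exact_mod_cast hm
  have hp : (0 : ℝ) < Fintype.card B := by exact_mod_cast Fintype.card_pos
  set J := Finset.Icc (-(m : ℤ)) m with hJ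
  set φ : ℤ → A → ℕ → ℝ := fun j a k =>
    Real.exp (θ * ((1 / m : ℝ) ^ 2 - (j / m : ℝ) ^ 2) + 2 * θ * (j / m) * (k - β a)) with hφ
  have hφ0 : ∀ j a k, 0 ≤ φ j a k := fun j a k => Real.exp_nonneg _
  have hpoint : ∀ η : ι → ℕ, Real.exp (∑ a, θ * (Fintype.card B *
        min (((Fintype.card B : ℝ)⁻¹ * ∑ b, (η (z (a, b)) : ℝ) - β a) ^ 2)
          |(Fintype.card B : ℝ)⁻¹ * ∑ b, (η (z (a, b)) : ℝ) - β a|)) ≤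
      ∑ σ ∈ Fintype.piFinset (fun _ : A => J), ∏ ab : A × B, φ (σ ab.1) ab.1 (η (z ab)) := by
    intro η
    have hprod : ∀ σ : A → ℤ, ∏ ab : A × B, φ (σ ab.1) ab.1 (η (z ab)) =
        ∏ a, ∏ b, φ (σ a) a (η (z (a, b))) := fun σ => Fintype.prod_prod_type _
    simp_rw [hprod]
    rw [← Finset.prod_univ_sum (fun _ : A => J) (fun a j => ∏ b, φ j a (η (z (a, b)))),
      Real.exp_sum]
    refine Finset.prod_le_prod (fun a _ => Real.exp_nonneg _) fun a _ => ?_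
    set x := (Fintype.card B : ℝ)⁻¹ * ∑ b, (η (z (a, b)) : ℝ) - β a with hx
    obtain ⟨j, hj, hle⟩ := exists_grid_min_sq_abs_le hm x
    refine le_trans ?_ (Finset.single_le_sum
      (fun j _ => Finset.prod_nonneg fun b _ => hφ0 j a (η (z (a, b)))) hj)
    rw [hφ, ← Real.exp_sum, Real.exp_le_exp, Finset.sum_add_distrib, ← Finset.mul_sum,
      Finset.sum_const, ← Finset.mul_sum, Finset.sum_sub_distrib, Finset.sum_const, Finset.card_univ,
      nsmul_eq_mul, nsmul_eq_mul]
    have hpx : ∑ b, (η (z (a, b)) : ℝ) - Fintype.card B * β a = Fintype.card B * x := by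
      rw [hx]
      field_simp
    rw [hpx]
    have := mul_le_mul_of_nonneg_left hle (mul_nonneg hθ hp.le)
    linarith
  have hsite : ∀ j ∈ J, ∀ a b, ∫⁻ k, ENNReal.ofReal (φ j a k) ∂(μ (z (a, b))) ≤
      ENNReal.ofReal (Real.exp (θ * ((1 / m : ℝ) ^ 2 + 2 * κ))) := by
    intro j hj a b
    obtain ⟨hj1, hj2⟩ := Finset.mem_Icc.1 hj
    have hy : |(j / m : ℝ)| ≤ 1 := by
      rw [abs_div, abs_of_pos hm0, div_le_one hm0, abs_le]
      exact ⟨by exact_mod_cast hj1, by exact_mod_cast hj2⟩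
    set y : ℝ := j / m
    have hc : |2 * θ * y| ≤ 2 * θ := by
      rw [abs_mul, abs_of_nonneg (by positivity : 0 ≤ 2 * θ)]
      exact mul_le_of_le_one_right (by positivity) hy
    simp only [hφ, Real.exp_add, ENNReal.ofReal_mul (Real.exp_nonneg _)]
    rw [lintegral_const_mul _ Measurable.of_discrete]
    refine (mul_le_mul_right (hmgf a b _ hc) _).trans ?_
    rw [← ENNReal.ofReal_mul (Real.exp_nonneg _), ← Real.exp_add]
    refine ENNReal.ofReal_le_ofReal (Real.exp_le_exp.2 ?_)
    have h1 : |2 * θ * y| * κ ≤ 2 * θ * κ := by gcongr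
    have h2 : 4 * K * θ * (θ * y ^ 2) ≤ 1 * (θ * y ^ 2) := by gcongr
    nlinarith
  calc _ ≤ ∫⁻ η, ∑ σ ∈ Fintype.piFinset (fun _ : A => J),
          ∏ ab : A × B, ENNReal.ofReal (φ (σ ab.1) ab.1 (η (z ab))) ∂(Measure.pi μ) := by
        refine lintegral_mono fun η => (ENNReal.ofReal_le_ofReal (hpoint η)).trans (le_of_eq ?_)
        rw [ENNReal.ofReal_sum_of_nonneg
          fun σ _ => Finset.prod_nonneg fun ab _ => hφ0 _ _ _]
        exact Finset.sum_congr rfl fun σ _ =>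
          ENNReal.ofReal_prod_of_nonneg fun ab _ => hφ0 _ _ _
    _ = ∑ σ ∈ Fintype.piFinset (fun _ : A => J),
          ∏ ab : A × B, ∫⁻ k, ENNReal.ofReal (φ (σ ab.1) ab.1 k) ∂(μ (z ab)) := by
        rw [lintegral_finsetSum _ fun σ _ => Measurable.of_discrete]
        exact Finset.sum_congr rfl fun σ _ => lintegral_pi_prod_of_injective μ hz
          (φ := fun ab k => ENNReal.ofReal (φ (σ ab.1) ab.1 k)) fun ab => Measurable.of_discrete
    _ ≤ ∑ σ ∈ Fintype.piFinset (fun _ : A => J),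
          ∏ _ab : A × B, ENNReal.ofReal (Real.exp (θ * ((1 / m : ℝ) ^ 2 + 2 * κ))) := by
        refine Finset.sum_le_sum fun σ hσ => Finset.prod_le_prod' fun ab _ => ?_
        exact hsite _ (Fintype.mem_piFinset.1 hσ ab.1) ab.1 ab.2
    _ = _ := by
        have hcard : J.card = 2 * m + 1 := by
          rw [hJ, Int.card_Icc]
          omega
        rw [Finset.prod_const, Finset.sum_const, Finset.card_univ, Fintype.card_prod,
          Fintype.card_piFinset, Finset.prod_const, Finset.card_univ, hcard, nsmul_eq_mul, ENNReal.ofReal_mul (by positivity),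
          ENNReal.ofReal_pow (by positivity), ENNReal.ofReal_pow (by positivity)]
        congr 1
        rw [show (2 * m + 1 : ℝ) = ((2 * m + 1 : ℕ) : ℝ) by push_cast; ring,
          ENNReal.ofReal_natCast]
        push_cast
        rfl

/-- Averaging over all translates of a finite family reduces an exponential moment of a sum over a
finite group to exponential moments of sums over the family. -/
theorem lintegral_exp_sum_le_of_translates {Ω G A : Type*} [MeasurableSpace Ω] [AddCommGroup G]
    [Fintype G] [Fintype A] [Nonempty A] (μ : Measure Ω) {H : G → Ω → ℝ}
    (hH : ∀ x, Measurable (H x)) (u : A → G) {D : ENNReal}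
    (hD : ∀ τ, ∫⁻ η, ENNReal.ofReal (Real.exp (∑ a,
      (Fintype.card G : ℝ) / Fintype.card A * H (τ + u a) η)) ∂μ ≤ D) :
    ∫⁻ η, ENNReal.ofReal (Real.exp (∑ x, H x η)) ∂μ ≤ D := by
  have hG : (0 : ℝ) < Fintype.card G := by exact_mod_cast Fintype.card_pos
  have hA : (0 : ℝ) < Fintype.card A := by exact_mod_cast Fintype.card_pos
  have hsum : ∀ η, ∑ x, H x η = ∑ τ : G, (Fintype.card G : ℝ)⁻¹ *
      ∑ a, (Fintype.card G : ℝ) / Fintype.card A * H (τ + u a) η := by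
    intro η
    have h1 : ∀ a, ∑ τ, H (τ + u a) η = ∑ x, H x η := fun a =>
      Equiv.sum_comp (Equiv.addRight (u a)) fun x => H x η
    rw [← Finset.mul_sum, Finset.sum_comm]
    simp_rw [← Finset.mul_sum, h1]
    rw [Finset.sum_const, Finset.card_univ, nsmul_eq_mul]
    field_simp
  have hpoint : ∀ η, Real.exp (∑ x, H x η) ≤ ∑ τ : G, (Fintype.card G : ℝ)⁻¹ *
      Real.exp (∑ a, (Fintype.card G : ℝ) / Fintype.card A * H (τ + u a) η) := by
    intro η
    rw [hsum]
    have h := convexOn_exp.map_sum_le (t := Finset.univ) (w := fun _ : G => (Fintype.card G : ℝ)⁻¹)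
      (p := fun τ => ∑ a, (Fintype.card G : ℝ) / Fintype.card A * H (τ + u a) η)
      (fun _ _ => by positivity) (by simp [hG.ne']) (fun _ _ => Set.mem_univ _)
    simpa only [smul_eq_mul] using h
  have hmeas : ∀ τ : G, Measurable fun η => ENNReal.ofReal (Real.exp (∑ a,
      (Fintype.card G : ℝ) / Fintype.card A * H (τ + u a) η)) := by
    intro τ
    refine (Real.measurable_exp.comp ?_).ennreal_ofReal
    exact Finset.measurable_sum _ fun a _ => (hH _).const_mul _
  calc _ ≤ ∫⁻ η, ∑ τ : G, ENNReal.ofReal (Fintype.card G : ℝ)⁻¹ * ENNReal.ofReal (Real.exp (∑ a,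
          (Fintype.card G : ℝ) / Fintype.card A * H (τ + u a) η)) ∂μ := by
        refine lintegral_mono fun η => (ENNReal.ofReal_le_ofReal (hpoint η)).trans (le_of_eq ?_)
        rw [ENNReal.ofReal_sum_of_nonneg fun τ _ => by positivity]
        exact Finset.sum_congr rfl fun τ _ => ENNReal.ofReal_mul (by positivity)
    _ = ∑ τ : G, ENNReal.ofReal (Fintype.card G : ℝ)⁻¹ * ∫⁻ η, ENNReal.ofReal (Real.exp (∑ a,
          (Fintype.card G : ℝ) / Fintype.card A * H (τ + u a) η)) ∂μ := by
        rw [lintegral_finsetSum _ fun τ _ => (hmeas τ).const_mul _]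
        exact Finset.sum_congr rfl fun τ _ => lintegral_const_mul _ (hmeas τ)
    _ ≤ ∑ _τ : G, ENNReal.ofReal (Fintype.card G : ℝ)⁻¹ * D :=
        Finset.sum_le_sum fun τ _ => mul_le_mul_right (hD τ) _
    _ = D := by
        rw [Finset.sum_const, Finset.card_univ, nsmul_eq_mul, ← mul_assoc,
          ← ENNReal.ofReal_natCast, ← ENNReal.ofReal_mul hG.le, mul_inv_cancel₀ hG.ne',
          ENNReal.ofReal_one, one_mul]

/-- The cube `{-l, …, l}^d`. -/
noncomputable abbrev boxOffsets (d l : ℕ) : Finset (Fin d → ℤ) :=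
  Fintype.piFinset (fun _ : Fin d => Finset.Icc (-(l : ℤ)) (l : ℤ))

theorem card_boxOffsets (d l : ℕ) : (boxOffsets d l).card = (2 * l + 1) ^ d := by
  rw [Fintype.card_piFinset, Finset.prod_const, Int.card_Icc, Finset.card_univ, Fintype.card_fin]
  congr 1
  omega

/-- Boxes of radius `l` centered at the points of a translate of `(2l+1){0, …, ⌊N/(2l+1)⌋ - 1}^d` are
pairwise disjoint. -/
theorem injective_translate_boxOffsets (d N l : ℕ) (τ : Fin d → ZMod N) :
    Function.Injective (fun (ab : (Fin d → Fin (N / (2 * l + 1))) × boxOffsets d l) (i : Fin d) =>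
      (τ + fun i => (((2 * l + 1) * (ab.1 i : ℕ) : ℕ) : ZMod N)) i + ((ab.2.1 i : ℤ) : ZMod N)) := by
  rintro ⟨a, v, hv⟩ ⟨a', v', hv'⟩ h
  have key : ∀ i, (a i : ℕ) = a' i ∧ v i = v' i := by
    intro i
    have hi := congrFun h i
    simp only [Pi.add_apply, add_assoc, add_right_inj] at hi
    have hi' : (((2 * l + 1 : ℕ) * (a i : ℕ) + v i : ℤ) : ZMod N) =
        (((2 * l + 1 : ℕ) * (a' i : ℕ) + v' i : ℤ) : ZMod N) := by
      push_cast at hi ⊢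
      exact hi
    rw [ZMod.intCast_eq_intCast_iff_dvd_sub] at hi'
    obtain ⟨h1, h2⟩ := Finset.mem_Icc.1 (Fintype.mem_piFinset.1 hv i)
    obtain ⟨h3, h4⟩ := Finset.mem_Icc.1 (Fintype.mem_piFinset.1 hv' i)
    have hlt := (a i).2
    have hlt' := (a' i).2
    generalize (a i : ℕ) = n at hi' hlt ⊢
    generalize (a' i : ℕ) = n' at hi' hlt' ⊢
    generalize hL : 2 * l + 1 = L at hi' hlt hlt'
    have hq : L * (N / L) ≤ N := Nat.mul_div_le N L
    have ha : L * n + L ≤ L * (N / L) := Nat.mul_le_mul_left L hlt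
    have ha' : L * n' + L ≤ L * (N / L) := Nat.mul_le_mul_left L hlt'
    generalize hA : L * n = A at ha
    generalize hA' : L * n' = A' at ha'
    have hA2 : (L : ℤ) * n = A := by exact_mod_cast hA
    have hA2' : (L : ℤ) * n' = A' := by exact_mod_cast hA'
    rw [hA2, hA2'] at hi'
    have hzero := Int.eq_zero_of_abs_lt_dvd hi' (by rw [abs_lt]; omega)
    have hdvd : (L : ℤ) ∣ v i - v' i :=
      ⟨n' - n, by rw [mul_sub, hA2, hA2']; omega⟩
    have hv0 := Int.eq_zero_of_abs_lt_dvd hdvd (by rw [abs_lt]; omega)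
    have hAA : A = A' := by omega
    exact ⟨Nat.eq_of_mul_eq_mul_left (by omega) (hA.trans (hAA.trans hA'.symm)), by omega⟩
  have e1 : a = a' := funext fun i => Fin.ext (key i).1
  have e2 : v = v' := funext fun i => (key i).2
  subst e1 e2
  rfl

theorem blockAvg_eq (d N l : ℕ) (x : Fin d → ZMod N) (η : (Fin d → ZMod N) → ℕ) :
    blockAvg d N l x η = (Fintype.card (boxOffsets d l) : ℝ)⁻¹ *
      ∑ v : boxOffsets d l, (η (fun i => x i + ((v.1 i : ℤ) : ZMod N)) : ℝ) := by
  rw [blockAvg, Fintype.card_coe, card_boxOffsets,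
    Finset.sum_coe_sort (boxOffsets d l) (fun v => (η (fun i => x i + ((v i : ℤ) : ZMod N)) : ℝ))]
  push_cast
  rfl

theorem blockAvg_nonneg (d N l : ℕ) (x : Fin d → ZMod N) (η : (Fin d → ZMod N) → ℕ) :
    0 ≤ blockAvg d N l x η := by
  unfold blockAvg
  positivity

/-- Exponential moment bound for sums of functions of block averages on the discrete torus. -/
theorem lintegral_exp_sum_blockAvg_le {d N l m : ℕ} [NeZero N] (hN : 2 * l + 1 ≤ N) (hm : 0 < m)
    (μ : (Fin d → ZMod N) → Measure ℕ) [∀ x, IsProbabilityMeasure (μ x)]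
    (β : (Fin d → ZMod N) → ℝ) (H : (Fin d → ZMod N) → ℝ → ℝ) {Θ K κ : ℝ} (hΘ : 0 ≤ Θ)
    (hκ : 0 ≤ κ) (hK : 4 * K * (2 ^ d * Θ) ≤ 1)
    (hH : ∀ x lam, 0 ≤ lam → H x lam ≤ Θ * min ((lam - β x) ^ 2) |lam - β x|)
    (hmgf : ∀ x, ∀ v ∈ boxOffsets d l, ∀ c, |c| ≤ 2 * (2 ^ d * Θ) →
      ∫⁻ k, ENNReal.ofReal (Real.exp (c * (k - β x)))
          ∂(μ (fun i => x i + ((v i : ℤ) : ZMod N))) ≤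
        ENNReal.ofReal (Real.exp (K * c ^ 2 + |c| * κ))) :
    ∫⁻ η, ENNReal.ofReal (Real.exp (∑ x, H x (blockAvg d N l x η))) ∂(Measure.pi μ) ≤
      ENNReal.ofReal (Real.exp ((N : ℝ) ^ d * (Real.log (2 * m + 1) / (2 * l + 1) ^ d +
        2 ^ d * Θ * ((1 / m : ℝ) ^ 2 + 2 * κ)))) := by
  set L := 2 * l + 1 with hL
  set q := N / L with hq
  have hL0 : 0 < L := by omega
  have hq0 : 0 < q := Nat.div_pos hN hL0
  have hqL : L * q ≤ N := Nat.mul_div_le N L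
  have hNq : N ≤ 2 * L * q := by
    have h1 : N < L * (q + 1) := Nat.lt_mul_div_succ N hL0
    nlinarith
  have : Nonempty (Fin q) := ⟨⟨0, hq0⟩⟩
  have hB : Fintype.card (boxOffsets d l) = L ^ d := by
    rw [Fintype.card_coe, card_boxOffsets]
  have : Nonempty (boxOffsets d l) := Fintype.card_pos_iff.1 (by rw [hB]; positivity)
  have hGc : Fintype.card (Fin d → ZMod N) = N ^ d := by simp [ZMod.card]
  have hAc : Fintype.card (Fin d → Fin q) = q ^ d := by simp
  refine lintegral_exp_sum_le_of_translates (A := Fin d → Fin q) (Measure.pi μ)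
    (H := fun x η => H x (blockAvg d N l x η)) (fun x => Measurable.of_discrete)
    (fun a i => ((L * (a i : ℕ) : ℕ) : ZMod N)) fun τ => ?_
  have hpack := lintegral_exp_packing_le μ (injective_translate_boxOffsets d N l τ)
    (fun a => β (τ + fun i => ((L * (a i : ℕ) : ℕ) : ZMod N))) (θ := 2 ^ d * Θ) (K := K) (κ := κ)
    (by positivity) hκ hK (fun a v c hc => hmgf _ v.1 v.2 c hc) hm
  simp only [← hL, ← blockAvg_eq] at hpack
  refine le_trans (lintegral_mono fun η => ENNReal.ofReal_le_ofReal (Real.exp_le_exp.2 ?_))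
    (hpack.trans (ENNReal.ofReal_le_ofReal ?_))
  · refine Finset.sum_le_sum fun a _ => ?_
    set x := τ + fun i => ((L * (a i : ℕ) : ℕ) : ZMod N)
    have h1 := hH x _ (blockAvg_nonneg d N l x η)
    set y := min ((blockAvg d N l x η - β x) ^ 2) |blockAvg d N l x η - β x|
    have hy : 0 ≤ y := le_min (sq_nonneg _) (abs_nonneg _)
    have h2 : (N : ℝ) ^ d / (q : ℝ) ^ d ≤ 2 ^ d * (L : ℝ) ^ d := by
      rw [div_le_iff₀ (by positivity), ← mul_pow, ← mul_pow]
      gcongr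
      exact_mod_cast hNq
    rw [hGc, hAc, hB]
    push_cast
    calc (N : ℝ) ^ d / (q : ℝ) ^ d * H x (blockAvg d N l x η)
        ≤ (N : ℝ) ^ d / (q : ℝ) ^ d * (Θ * y) := by gcongr
      _ ≤ 2 ^ d * (L : ℝ) ^ d * (Θ * y) := by gcongr
      _ = _ := by ring
  · have hm1 : (0 : ℝ) < 2 * m + 1 := by positivity
    have hlog : 0 ≤ Real.log (2 * m + 1) := Real.log_nonneg (by linarith [(m.cast_nonneg : (0 : ℝ) ≤ m)])
    have hcard : (q : ℝ) ^ d * (L : ℝ) ^ d ≤ (N : ℝ) ^ d := by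
      rw [← mul_pow]
      gcongr
      rw [mul_comm]
      exact_mod_cast hqL
    have hLr : (L : ℝ) = 2 * l + 1 := by rw [hL]; push_cast; ring
    rw [hAc, hB, ← Real.exp_nat_mul, ← Real.exp_log (pow_pos hm1 (q ^ d)), ← Real.exp_add,
      Real.log_pow, Real.exp_le_exp, mul_add ((N : ℝ) ^ d), ← hLr]
    push_cast
    refine add_le_add ?_ ?_
    · rw [mul_div_assoc', le_div_iff₀ (by positivity), mul_right_comm]
      gcongr
    · gcongr

theorem dist_embed_add_le {d N l : ℕ} [NeZero N] (x : Fin d → ZMod N) {v : Fin d → ℤ}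
    (hv : v ∈ boxOffsets d l) :
    dist (embed d N (fun i => x i + ((v i : ℤ) : ZMod N))) (embed d N x) ≤ l / N := by
  have hN : (0 : ℝ) < N := by exact_mod_cast NeZero.pos N
  refine (dist_pi_le_iff (by positivity)).2 fun i => ?_
  have he : ∀ y : Fin d → ZMod N, embed d N y i = ZMod.toAddCircle (y i) := fun y =>
    (ZMod.toAddCircle_apply (y i)).symm
  rw [he, he, map_add, dist_eq_norm, add_sub_cancel_left, ZMod.toAddCircle_intCast]
  refine (QuotientAddGroup.norm_mk_le_norm).trans ?_
  obtain ⟨h1, h2⟩ := Finset.mem_Icc.1 (Fintype.mem_piFinset.1 hv i)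
  rw [Real.norm_eq_abs, abs_div, abs_of_pos hN]
  gcongr
  rw [abs_le]
  exact ⟨by exact_mod_cast h1, by exact_mod_cast h2⟩

theorem limsup_le_of_eventually_le_of_nonneg {u : ℕ → ℝ} {ε : ℝ} (hε : 0 ≤ ε)
    (h : ∀ᶠ n in Filter.atTop, u n ≤ ε) : Filter.limsup u Filter.atTop ≤ ε := by
  rw [Filter.limsup_eq]
  by_cases hb : BddBelow {a | ∀ᶠ n in Filter.atTop, u n ≤ a}
  · exact csInf_le hb h
  · rwa [Real.sInf_of_not_bddBelow hb]

theorem intervalIntegral_le_mul_of_le {f : ℝ → ℝ} {t c : ℝ} (ht : 0 ≤ t) (hc : 0 ≤ c)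
    (h : ∀ s ∈ Set.Icc 0 t, f s ≤ c) : ∫ s in (0 : ℝ)..t, f s ≤ t * c := by
  by_cases hf : IntervalIntegrable f volume 0 t
  · refine (intervalIntegral.integral_mono_on ht hf intervalIntegrable_const h).trans ?_
    simp
  · rw [intervalIntegral.integral_undef hf]
    positivity

theorem log_integral_exp_le {Ω : Type*} [MeasurableSpace Ω] {μ : Measure Ω} {f : Ω → ℝ} {E : ℝ}
    (hf : Measurable f) (hE : 0 ≤ E)
    (h : ∫⁻ η, ENNReal.ofReal (Real.exp (f η)) ∂μ ≤ ENNReal.ofReal (Real.exp E)) :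
    Real.log (∫ η, Real.exp (f η) ∂μ) ≤ E := by
  have h1 : ∫ η, Real.exp (f η) ∂μ ≤ Real.exp E := by
    rw [integral_eq_lintegral_of_nonneg_ae (Filter.Eventually.of_forall fun η => Real.exp_nonneg _)
      (Real.measurable_exp.comp hf).aestronglyMeasurable]
    exact ENNReal.toReal_le_of_le_ofReal (Real.exp_nonneg _) h
  rcases (integral_nonneg fun η => Real.exp_nonneg (f η) : 0 ≤ ∫ η, Real.exp (f η) ∂μ).eq_or_lt
    with h0 | h0
  · rw [← h0, Real.log_zero]
    exact hE
  · exact (Real.log_le_iff_le_exp h0).2 h1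

theorem exists_lt_summable {g : ℕ → ℝ} {psiStar : ENNReal}
    (hrad : ∀ ψ : ℝ, 0 ≤ ψ → ENNReal.ofReal ψ < psiStar →
      Summable (fun k : ℕ => ψ ^ k / gFact g k)) {ψ : ℝ} (hψ : ENNReal.ofReal ψ < psiStar) :
    ∃ r, ψ < r ∧ 0 < r ∧ Summable (fun k : ℕ => r ^ k / gFact g k) := by
  obtain ⟨r, hr0, h1, h2⟩ := ENNReal.lt_iff_exists_real_btwn.1 hψ
  obtain ⟨h3, h4⟩ := ENNReal.ofReal_lt_ofReal_iff'.1 h1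
  exact ⟨r, h3, h4, hrad r hr0 h2⟩

/-- Uniformly over densities in `[0, δ₁]`, the centered occupation number under `ν_α` has
sub-Gaussian exponential moments near the origin. -/
theorem exists_mgf_bound {g : ℕ → ℝ} (hpos : ∀ k, 0 < gFact g k) {psiStar : ENNReal}
    (hrad : ∀ ψ : ℝ, 0 ≤ ψ → ENNReal.ofReal ψ < psiStar →
      Summable (fun k : ℕ => ψ ^ k / gFact g k))
    {Φ : ℝ → ℝ} (hΦ0 : Φ 0 = 0) (hmono : StrictMonoOn Φ (Set.Ici 0))
    (hΦ_range : ∀ α : ℝ, 0 ≤ α → 0 ≤ Φ α ∧ ENNReal.ofReal (Φ α) < psiStar)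
    (hΦ_inv : ∀ α : ℝ, 0 ≤ α → meanR g (Φ α) = α) {δ₁ : ℝ} (hδ₁ : 0 < δ₁) :
    ∃ a₀ K : ℝ, 0 < a₀ ∧ 0 ≤ K ∧ ∀ α ∈ Set.Icc 0 δ₁, ∀ a, |a| ≤ a₀ →
      ∫⁻ k, ENNReal.ofReal (Real.exp (a * (k - α))) ∂(siteMeasure g (Φ α)) ≤
        ENNReal.ofReal (Real.exp (K * a ^ 2)) := by
  have hψ₁ : 0 < Φ δ₁ := hΦ0 ▸ hmono Set.self_mem_Ici hδ₁.le hδ₁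
  obtain ⟨r, hr, hr0, hsr⟩ := exists_lt_summable hrad (hΦ_range δ₁ hδ₁.le).2
  have hZ := one_le_partZ hpos hr0.le hsr
  have ha₀ : 0 < Real.log (r / Φ δ₁) / 2 := half_pos (Real.log_pos ((one_lt_div hψ₁).2 hr))
  refine ⟨Real.log (r / Φ δ₁) / 2, _, ha₀, ?_, fun α hα a ha =>
    lintegral_siteMeasure_exp_le hpos (hΦ_range α hα.1).1 ha₀ ?_ hα.1 hα.2 (hΦ_inv α hα.1) hsr ?_ ha⟩
  · positivity
  · have hle : Φ α ≤ Φ δ₁ := hmono.monotoneOn hα.1 hδ₁.le hα.2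
    rw [mul_div_cancel₀ _ two_ne_zero, Real.exp_log (div_pos hr0 hψ₁)]
    calc Φ α * (r / Φ δ₁) ≤ Φ δ₁ * (r / Φ δ₁) := by gcongr
      _ = r := by field_simp
  · exact (hmono.monotoneOn hα.1 hδ₁.le hα.2).trans_lt hr

/-- A continuous function of time and of the macroscopic position varies little over microscopic boxes,
uniformly in bounded time. -/
theorem eventually_abs_sub_embed_le {d : ℕ} {ρ : ℝ → (Fin d → AddCircle (1 : ℝ)) → ℝ}
    (hρ_cont : Continuous (fun p : ℝ × (Fin d → AddCircle (1 : ℝ)) => ρ p.1 p.2)) (T : ℝ) {κ : ℝ}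
    (hκ : 0 < κ) (l : ℕ) :
    ∀ᶠ N : ℕ in Filter.atTop, ∀ s ∈ Set.Icc 0 T, ∀ x : Fin d → ZMod (N + 1),
      ∀ v ∈ boxOffsets d l,
        |ρ s (embed d (N + 1) (fun i => x i + ((v i : ℤ) : ZMod (N + 1)))) -
          ρ s (embed d (N + 1) x)| ≤ κ := by
  have : Fact ((0 : ℝ) < 1) := ⟨one_pos⟩
  have hU := (isCompact_Icc (a := (0 : ℝ)) (b := T)).prod
    (isCompact_univ (X := Fin d → AddCircle (1 : ℝ))) |>.uniformContinuousOn_of_continuous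
      hρ_cont.continuousOn
  obtain ⟨r, hr, hU⟩ := Metric.uniformContinuousOn_iff.1 hU κ hκ
  have hlim : Filter.Tendsto (fun N : ℕ => (l : ℝ) / ((N + 1 : ℕ) : ℝ)) Filter.atTop (nhds 0) :=
    (tendsto_const_div_atTop_nhds_zero_nat (l : ℝ)).comp (Filter.tendsto_add_atTop_nat 1)
  filter_upwards [hlim.eventually (gt_mem_nhds hr)] with N hN s hs x v hv
  have h := hU (s, embed d (N + 1) (fun i => x i + ((v i : ℤ) : ZMod (N + 1)))) ⟨hs, trivial⟩
    (s, embed d (N + 1) x) ⟨hs, trivial⟩ ?_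
  · exact (Real.dist_eq _ _ ▸ h).le
  · rw [Prod.dist_eq, dist_self]
    exact max_lt hr ((dist_embed_add_le x hv).trans_lt hN)

theorem eventually_error_le {d m : ℕ} (hd : 1 ≤ d) {e : ℝ} (he : 0 < e) :
    ∀ᶠ l : ℕ in Filter.atTop, Real.log (2 * m + 1) / (2 * l + 1 : ℝ) ^ d ≤ e := by
  have hlog : 0 ≤ Real.log (2 * m + 1) :=
    Real.log_nonneg (by linarith [(m.cast_nonneg : (0 : ℝ) ≤ m)])
  have hlim := tendsto_const_div_atTop_nhds_zero_nat (Real.log (2 * m + 1))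
  filter_upwards [hlim.eventually (gt_mem_nhds he), Filter.eventually_gt_atTop 0] with l hl hl0
  refine le_trans ?_ hl.le
  have hl1 : (0 : ℝ) < l := by exact_mod_cast hl0
  have h1 : (2 * l + 1 : ℝ) ≤ (2 * l + 1) ^ d := le_self_pow₀ (by linarith) (by omega)
  gcongr
  linarith

theorem convex_exponential_estimate
    (d : ℕ) (hd : 1 ≤ d)
    (g : ℕ → ℝ) (hg_nonneg : ∀ k, 0 ≤ g k) (hg_zero : ∀ k, g k = 0 ↔ k = 0)
    (b : ℝ) (hb : 0 < b) (hG : ∀ k : ℕ, g k ^ 2 ≤ b * k)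
    (psiStar : ENNReal) (hpsiStar : 0 < psiStar)
    (hrad : ∀ ψ : ℝ, 0 ≤ ψ → ENNReal.ofReal ψ < psiStar →
      Summable (fun k : ℕ => ψ ^ k / gFact g k))
    (hZinf : ∀ s : ℝ, ENNReal.ofReal s = psiStar →
      Filter.Tendsto (partZ g) (nhdsWithin s (Set.Iio s)) Filter.atTop)
    (Φ Φ' : ℝ → ℝ) (hΦ0 : Φ 0 = 0)
    (hΦ_range : ∀ α : ℝ, 0 ≤ α → 0 ≤ Φ α ∧ ENNReal.ofReal (Φ α) < psiStar)
    (hΦ_inv : ∀ α : ℝ, 0 ≤ α → meanR g (Φ α) = α)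
    (hΦ_deriv : ∀ α : ℝ, 0 ≤ α → HasDerivAt Φ (Φ' α) α ∧ 0 < Φ' α)
    (hΦ'_cont : ContinuousOn Φ' (Set.Ici 0))
    (T : ℝ) (hT : 0 < T)
    (δ₀ δ₁ : ℝ) (hδ₀ : 0 < δ₀) (hδ : δ₀ ≤ δ₁)
    (ρ : ℝ → (Fin d → AddCircle (1 : ℝ)) → ℝ)
    (hρ_cont : Continuous (fun p : ℝ × (Fin d → AddCircle (1 : ℝ)) => ρ p.1 p.2))
    (hρ : ∀ s u, δ₀ ≤ ρ s u ∧ ρ s u ≤ δ₁)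
    (F : ℝ → (Fin d → AddCircle (1 : ℝ)) → ℝ)
    (hF_cont : Continuous (fun p : ℝ × (Fin d → AddCircle (1 : ℝ)) => F p.1 p.2))
    (CF : ℝ) (hF_bdd : ∀ s u, |F s u| ≤ CF) :
    ∃ γ₂ : ℝ, 0 < γ₂ ∧ ∀ γ : ℝ, 0 < γ → γ < γ₂ → ∀ t ∈ Set.Icc (0 : ℝ) T,
      Filter.limsup (fun l : ℕ =>
        Filter.limsup (fun N : ℕ =>
          (γ * ((N + 1 : ℕ) : ℝ) ^ d)⁻¹ *
            ∫ s in (0 : ℝ)..t, Real.log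
              (∫ η : (Fin d → ZMod (N + 1)) → ℕ,
                Real.exp (γ * ∑ x : Fin d → ZMod (N + 1),
                  F s (embed d (N + 1) x) *
                    Mfun Φ Φ' (blockAvg d (N + 1) l x η) (ρ s (embed d (N + 1) x)))
                ∂(Measure.pi (fun x : Fin d → ZMod (N + 1) =>
                    siteMeasure g (Φ (ρ s (embed d (N + 1) x)))))))
          Filter.atTop) Filter.atTop ≤ 0 := by
  have hpos := gFact_pos hg_nonneg hg_zero
  have hδ₁ : 0 < δ₁ := hδ₀.trans_le hδ
  have hmono : StrictMonoOn Φ (Set.Ici 0) := by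
    refine strictMonoOn_of_deriv_pos (convex_Ici 0)
      (fun α hα => (hΦ_deriv α hα).1.continuousAt.continuousWithinAt) fun α hα => ?_
    rw [interior_Ici] at hα
    rw [(hΦ_deriv α hα.le).1.deriv]
    exact (hΦ_deriv α hα.le).2
  have hgrowth : ∀ α, 0 ≤ α → Φ α ^ 2 ≤ b * α := by
    intro α hα
    obtain ⟨h1, h2⟩ := hΦ_range α hα
    obtain ⟨r, hr, -, hsr⟩ := exists_lt_summable hrad h2
    have h := sq_le_mul_meanR hpos ((hg_zero 0).2 rfl) hG h1 hr (hrad _ h1 h2) hsr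
    rwa [hΦ_inv α hα] at h
  have hanalytic : ∀ α, 0 < α → AnalyticAt ℝ (meanR g) (Φ α) := by
    intro α hα
    obtain ⟨h1, h2⟩ := hΦ_range α hα.le
    obtain ⟨r', hr', -, hsr'⟩ := exists_lt_summable hrad h2
    obtain ⟨r, hr, hrr'⟩ := exists_between hr'
    exact analyticAt_meanR hpos h1 hr hrr' hsr'
  obtain ⟨hΦC, hΦ'C⟩ := contDiffOn_deriv_of_inverse hanalytic (fun α hα => hΦ_inv α hα.le)
    (fun α hα => (hΦ_deriv α hα.le).1) (hΦ'_cont.mono Set.Ioi_subset_Ici_self)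
  obtain ⟨C, hC, hM⟩ := exists_abs_Mfun_le hb hδ₀ hδ hgrowth
    (fun α hα => (hΦ_deriv α hα.le).1) hΦC hΦ'C
  obtain ⟨a₀, K, ha₀, hK, hmgf⟩ := exists_mgf_bound hpos hrad hΦ0 hmono hΦ_range hΦ_inv hδ₁
  have hprob : ∀ α, 0 ≤ α → IsProbabilityMeasure (siteMeasure g (Φ α)) := fun α hα =>
    isProbabilityMeasure_siteMeasure hpos (hΦ_range α hα).1
      (hrad _ (hΦ_range α hα).1 (hΦ_range α hα).2)
  have hCF : 0 ≤ CF := (abs_nonneg _).trans (hF_bdd 0 0)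
  have hden : 0 < 2 ^ d * ((CF + 1) * C) := by positivity
  refine ⟨min (a₀ / 2) (1 / (4 * (K + 1))) / (2 ^ d * ((CF + 1) * C)), by positivity,
    fun γ hγ hγ₂ t ht => ?_⟩
  set Θ := γ * ((CF + 1) * C) with hΘ
  have hΘ0 : 0 < Θ := by positivity
  have hθ : 2 ^ d * Θ < min (a₀ / 2) (1 / (4 * (K + 1))) := by
    rw [lt_div_iff₀ hden] at hγ₂
    rw [hΘ]
    linarith
  obtain ⟨hθa, hθK⟩ := lt_min_iff.1 hθ
  rw [lt_div_iff₀ (by positivity)] at hθK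
  set θ := 2 ^ d * Θ with hθdef
  have hθ0 : 0 < θ := by positivity
  have hKθ : 4 * K * θ ≤ 1 := by nlinarith
  have hH : ∀ s u lam, 0 ≤ lam → γ * (F s u * Mfun Φ Φ' lam (ρ s u)) ≤
      Θ * min ((lam - ρ s u) ^ 2) |lam - ρ s u| := by
    intro s u lam hlam
    have h1 := hM (ρ s u) (hρ s u) lam hlam
    have h2 := hF_bdd s u
    rw [hΘ, mul_assoc, mul_assoc]
    refine mul_le_mul_of_nonneg_left ((le_abs_self _).trans ?_) hγ.le
    rw [abs_mul]
    gcongr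
    linarith
  refine le_of_forall_pos_le_add fun ε hε => ?_
  rw [zero_add]
  set e := ε * γ / T with he
  have he0 : 0 < e := by positivity
  obtain ⟨m, hm, hme⟩ : ∃ m : ℕ, 0 < m ∧ (1 / m : ℝ) ^ 2 ≤ e / (3 * θ) := by
    have hlim : Filter.Tendsto (fun m : ℕ => (1 / m : ℝ) ^ 2) Filter.atTop (nhds 0) := by
      simpa using (tendsto_one_div_atTop_nhds_zero_nat (𝕜 := ℝ)).pow 2
    obtain ⟨m, h1, h2⟩ := ((Filter.eventually_gt_atTop 0).and
      (hlim.eventually (gt_mem_nhds (show 0 < e / (3 * θ) by positivity)))).exists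
    exact ⟨m, h1, h2.le⟩
  set κ := e / (6 * θ) with hκ
  have hκ0 : 0 < κ := by positivity
  refine limsup_le_of_eventually_le_of_nonneg hε.le ?_
  filter_upwards [eventually_error_le (m := m) hd (show 0 < e / 3 by positivity)] with l hl
  refine limsup_le_of_eventually_le_of_nonneg hε.le ?_
  filter_upwards [eventually_abs_sub_embed_le hρ_cont T hκ0 l, Filter.eventually_ge_atTop (2 * l)]
    with N hN hNl
  have hX : Real.log (2 * m + 1) / (2 * l + 1) ^ d + θ * ((1 / m : ℝ) ^ 2 + 2 * κ) ≤ e := by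
    have h1 : θ * (1 / m : ℝ) ^ 2 ≤ θ * (e / (3 * θ)) := by gcongr
    have h2 : θ * (e / (3 * θ)) = e / 3 := by field_simp
    have h3 : θ * (2 * κ) = e / 3 := by rw [hκ]; field_simp; norm_num
    linarith
  have hNd : (0 : ℝ) < ((N + 1 : ℕ) : ℝ) ^ d := by positivity
  have hlog : ∀ s ∈ Set.Icc 0 t, Real.log (∫ η : (Fin d → ZMod (N + 1)) → ℕ,
      Real.exp (γ * ∑ x : Fin d → ZMod (N + 1), F s (embed d (N + 1) x) *
        Mfun Φ Φ' (blockAvg d (N + 1) l x η) (ρ s (embed d (N + 1) x)))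
      ∂(Measure.pi (fun x : Fin d → ZMod (N + 1) =>
        siteMeasure g (Φ (ρ s (embed d (N + 1) x)))))) ≤ ((N + 1 : ℕ) : ℝ) ^ d * e := by
    intro s hs
    have hρ0 : ∀ u, 0 ≤ ρ s u := fun u => hδ₀.le.trans (hρ s u).1
    have : ∀ x : Fin d → ZMod (N + 1),
        IsProbabilityMeasure (siteMeasure g (Φ (ρ s (embed d (N + 1) x)))) :=
      fun x => hprob _ (hρ0 _)
    refine log_integral_exp_le Measurable.of_discrete (by positivity) ?_
    simp only [Finset.mul_sum]
    refine (lintegral_exp_sum_blockAvg_le (N := N + 1) (l := l) (K := K) (κ := κ) (by omega) hm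
      (fun x => siteMeasure g (Φ (ρ s (embed d (N + 1) x)))) (fun x => ρ s (embed d (N + 1) x))
      (fun x lam => γ * (F s (embed d (N + 1) x) * Mfun Φ Φ' lam (ρ s (embed d (N + 1) x))))
      hΘ0.le hκ0.le hKθ (fun x lam hlam => hH s _ lam hlam) ?_).trans ?_
    · intro x v hv c hc
      have hclose := hN s ⟨hs.1, hs.2.trans ht.2⟩ x v hv
      set β := ρ s (embed d (N + 1) x)
      set α := ρ s (embed d (N + 1) (fun i => x i + ((v i : ℤ) : ZMod (N + 1)))) with hα
      have hsplit : ∀ k : ℕ, ENNReal.ofReal (Real.exp (c * (k - β))) =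
          ENNReal.ofReal (Real.exp (c * (α - β))) * ENNReal.ofReal (Real.exp (c * (k - α))) := by
        intro k
        rw [← ENNReal.ofReal_mul (Real.exp_nonneg _), ← Real.exp_add]
        ring_nf
      simp_rw [hsplit]
      rw [lintegral_const_mul _ Measurable.of_discrete]
      refine (mul_le_mul_right (hmgf α ⟨hρ0 _, (hρ s _).2⟩ c (by linarith)) _).trans ?_
      rw [← ENNReal.ofReal_mul (Real.exp_nonneg _), ← Real.exp_add]
      refine ENNReal.ofReal_le_ofReal (Real.exp_le_exp.2 ?_)
      have h1 : c * (α - β) ≤ |c| * κ := by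
        refine (le_abs_self _).trans ?_
        rw [abs_mul]
        gcongr
      linarith
    · refine ENNReal.ofReal_le_ofReal (Real.exp_le_exp.2 ?_)
      gcongr
  have hbound_integral := intervalIntegral_le_mul_of_le ht.1 (by positivity) hlog
  calc _ ≤ (γ * ((N + 1 : ℕ) : ℝ) ^ d)⁻¹ * (t * (((N + 1 : ℕ) : ℝ) ^ d * e)) := by gcongr
    _ = t * e / γ := by field_simp
    _ ≤ T * e / γ := by
        gcongr
        exact ht.2
    _ = ε := by
        rw [he]
        field_simp
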